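/- arXiv:1306.6810 — 2 statements merged into one kernel-verified Lean document; each statement's English description precedes it below -/
import Mathlib

section
/- Let n ≥ 2, let g be a pseudo-Riemannian metric of class C^2 on an open set U ⊆ ℝ^n, let a = (a^{ij}) be a symmetric family of functions of class C^1 on U and λ = (λ^i) continuous functions on U satisfying ∂_k a^{ij} + Γ^i_{kα} a^{αj} + Γ^j_{kα} a^{iα} = λ^i δ^j_k + λ^j δ^i_k on U for all i, j, k. Then for any pair of distinct indices i ≠ k the identity (1/2) ∂_i a^{ii} − ∂_k a^{ik} = a^{kα} Γ^i_{αk} + a^{iα} Γ^k_{αk} − a^{iα} Γ^i_{αi} holds on U (no summation over i or k; summation over α), and consequently the second partial derivative ∂_k ∂_k a^{ik} exists and is continuous on U. -/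
noncomputable section
open scoped BigOperators

/-- Partial derivative `∂_i f` of `f : ℝⁿ → ℝ` in the `i`-th coordinate direction. -/
def pd {n : ℕ} (i : Fin n) (f : (Fin n → ℝ) → ℝ) (x : Fin n → ℝ) : ℝ :=
  fderiv ℝ f x (Pi.single i 1)

/-- The matrix `(g_{ij}(x))` of a two-index family of functions at a point `x`. -/
def matAt {n : ℕ} (g : Fin n → Fin n → (Fin n → ℝ) → ℝ) (x : Fin n → ℝ) :
    Matrix (Fin n) (Fin n) ℝ := Matrix.of fun i j => g i j x

/-- The components `g^{ij}(x)` of the pointwise inverse matrix. -/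
def ginv {n : ℕ} (g : Fin n → Fin n → (Fin n → ℝ) → ℝ) (i j : Fin n) (x : Fin n → ℝ) : ℝ :=
  (matAt g x)⁻¹ i j

/-- `g` is a pseudo-Riemannian metric of class `C^r` on `U`: the components are
symmetric, of class `C^r`, and the matrix `(g_{ij}(x))` is invertible for every `x ∈ U`. -/
structure IsMetric {n : ℕ} (r : WithTop ℕ∞) (g : Fin n → Fin n → (Fin n → ℝ) → ℝ)
    (U : Set (Fin n → ℝ)) : Prop where
  symm : ∀ i j, ∀ x ∈ U, g i j x = g j i x
  contDiff : ∀ i j, ContDiffOn ℝ r (g i j) U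
  inv : ∀ x ∈ U, IsUnit (matAt g x).det

/-- Christoffel symbols `Γ^h_{ij} = (1/2) g^{hk}(∂_i g_{jk} + ∂_j g_{ik} − ∂_k g_{ij})`. -/
def Christoffel {n : ℕ} (g : Fin n → Fin n → (Fin n → ℝ) → ℝ) (h i j : Fin n)
    (x : Fin n → ℝ) : ℝ :=
  (1/2) * ∑ k, ginv g h k x * (pd i (g j k) x + pd j (g i k) x - pd k (g i j) x)

/-- `g` and `gbar` are geodesically related via the 1-form `ψ`:
`Γ̄^h_{ij} = Γ^h_{ij} + ψ_i δ^h_j + ψ_j δ^h_i` on `U`. -/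
def GeodesicallyRelated {n : ℕ} (g gbar : Fin n → Fin n → (Fin n → ℝ) → ℝ)
    (ψ : Fin n → (Fin n → ℝ) → ℝ) (U : Set (Fin n → ℝ)) : Prop :=
  ∀ h i j, ∀ x ∈ U, Christoffel gbar h i j x =
    Christoffel g h i j x + ψ i x * (if h = j then (1:ℝ) else 0)
      + ψ j x * (if h = i then (1:ℝ) else 0)

open Filter Topology

/-- Interchange of directional derivatives: if `u` is differentiable near `x` and its derivative
in the direction `w` is strictly differentiable at `x`, then the derivative of `u` in any direction
`v` has a derivative at `x` in the direction `w`. -/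
theorem hasLineDerivAt_fderiv_apply_of_hasStrictFDerivAt {E : Type*} [NormedAddCommGroup E]
    [NormedSpace ℝ E] {u F : E → ℝ} {F' : E →L[ℝ] ℝ} {x v w : E}
    (hu : ∀ᶠ y in 𝓝 x, DifferentiableAt ℝ u y)
    (hF : ∀ᶠ y in 𝓝 x, fderiv ℝ u y w = F y) (hF' : HasStrictFDerivAt F F' x) :
    HasLineDerivAt ℝ (fun y => fderiv ℝ u y v) (F' v) x w := by
  have hshift : Tendsto (fun p : ℝ × ℝ => x + p.2 • w + p.1 • v) (𝓝[≠] 0 ×ˢ 𝓝 0) (𝓝 x) := by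
    have hc : Continuous (fun p : ℝ × ℝ => x + p.2 • w + p.1 • v) := by fun_prop
    have := hc.tendsto (0, 0)
    simp only [zero_smul, add_zero, nhds_prod_eq] at this
    exact this.mono_left (Filter.prod_mono nhdsWithin_le_nhds le_rfl)
  have hbase : Tendsto (fun t : ℝ => x + t • w) (𝓝 0) (𝓝 x) := by
    have hc : Continuous (fun t : ℝ => x + t • w) := by fun_prop
    simpa using hc.tendsto 0
  have hbase' : Tendsto (fun p : ℝ × ℝ => x + p.2 • w) (𝓝[≠] 0 ×ˢ 𝓝 0) (𝓝 x) :=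
    hbase.comp tendsto_snd
  have hline : ∀ (y : E) (t : ℝ), DifferentiableAt ℝ u (y + t • w) →
      HasDerivAt (fun t : ℝ => u (y + t • w)) (fderiv ℝ u (y + t • w) w) t := by
    intro y t h
    have h1 : HasDerivAt (fun t : ℝ => y + t • w) w t := by
      simpa using ((hasDerivAt_id t).smul_const w).const_add y
    exact h.hasFDerivAt.comp_hasDerivAt t h1
  refine hasDerivAt_of_tendstoUniformlyOnFilter (l := 𝓝[≠] (0 : ℝ))
    (f := fun s t => s⁻¹ * (u (x + t • w + s • v) - u (x + t • w)))
    (f' := fun s t => s⁻¹ * (F (x + t • w + s • v) - F (x + t • w)))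
    (g' := fun _ => F' v) ?_ ?_ ?_
  · rw [Metric.tendstoUniformlyOnFilter_iff]
    intro ε hε
    have hpos : 0 < ε / (‖v‖ + 1) := by positivity
    have hb := (hshift.prodMk_nhds hbase').eventually (hF'.isLittleO.bound hpos)
    have hs : ∀ᶠ p : ℝ × ℝ in 𝓝[≠] 0 ×ˢ 𝓝 0, p.1 ≠ 0 :=
      tendsto_fst.eventually (eventually_mem_nhdsWithin)
    filter_upwards [hb, hs] with p hp hp0
    simp only [add_sub_cancel_left, map_smul, smul_eq_mul, norm_smul] at hp
    have hp1 : 0 < ‖p.1‖ := norm_pos_iff.2 hp0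
    have heq : p.1⁻¹ * (F (x + p.2 • w + p.1 • v) - F (x + p.2 • w)) - F' v
        = p.1⁻¹ * (F (x + p.2 • w + p.1 • v) - F (x + p.2 • w) - p.1 * F' v) := by
      field_simp
    rw [dist_comm, dist_eq_norm, heq, norm_mul, norm_inv, inv_mul_lt_iff₀ hp1]
    refine hp.trans_lt ?_
    have : ε / (‖v‖ + 1) * ‖v‖ < ε := by
      rw [div_mul_eq_mul_div, div_lt_iff₀ (by positivity)]
      nlinarith
    nlinarith
  · filter_upwards [hshift.eventually hu, hshift.eventually hF, hbase'.eventually hu,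
      hbase'.eventually hF] with p h1 h2 h3 h4
    have hcomm : ∀ t : ℝ, x + t • w + p.1 • v = x + p.1 • v + t • w := fun t => by abel
    rw [hcomm] at h1 h2
    have h5 := ((hline _ _ h1).sub (hline _ _ h3)).const_mul p.1⁻¹
    rw [h2, h4] at h5
    simp only [hcomm]
    exact h5
  · filter_upwards [hbase.eventually hu] with t ht
    have h := (ht.hasFDerivAt.hasLineDerivAt v).tendsto_slope_zero
    simpa using h

section Metric

variable {n : ℕ} {U : Set (Fin n → ℝ)} {g : Fin n → Fin n → (Fin n → ℝ) → ℝ}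

theorem contDiffOn_pd {f : (Fin n → ℝ) → ℝ} {r s : WithTop ℕ∞} (hU : IsOpen U)
    (hf : ContDiffOn ℝ r f U) (hrs : s + 1 ≤ r) (i : Fin n) : ContDiffOn ℝ s (pd i f) U :=
  (hf.fderiv_of_isOpen hU hrs).clm_apply contDiffOn_const

theorem contDiffOn_det {E ι : Type*} [NormedAddCommGroup E] [NormedSpace ℝ E] [Fintype ι]
    [DecidableEq ι] {r : WithTop ℕ∞} {s : Set E} {A : E → Matrix ι ι ℝ}
    (hA : ∀ i j, ContDiffOn ℝ r (fun x => A x i j) s) :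
    ContDiffOn ℝ r (fun x => (A x).det) s := by
  simp only [Matrix.det_apply']
  exact ContDiffOn.sum fun σ _ => contDiffOn_const.mul (contDiffOn_prod fun i _ => hA _ _)

theorem IsMetric.contDiffOn_ginv {r : WithTop ℕ∞} (hg : IsMetric r g U) (i j : Fin n) :
    ContDiffOn ℝ r (ginv g i j) U := by
  have heq : ginv g i j =
      fun x => (matAt g x).det⁻¹ * ((matAt g x).updateRow j (Pi.single i 1)).det := by
    funext x
    simp [ginv, Matrix.inv_def, Matrix.adjugate_apply]
  rw [heq]
  refine ContDiffOn.mul (ContDiffOn.inv (contDiffOn_det hg.contDiff) fun x hx =>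
    (hg.inv x hx).ne_zero) (contDiffOn_det fun p q => ?_)
  by_cases hp : p = j
  · simpa [Matrix.updateRow_apply, hp] using contDiffOn_const
  · simpa [Matrix.updateRow_apply, hp, matAt] using hg.contDiff p q

theorem IsMetric.contDiffOn_christoffel {r s : WithTop ℕ∞} (hU : IsOpen U) (hg : IsMetric r g U)
    (hrs : s + 1 ≤ r) (h i j : Fin n) : ContDiffOn ℝ s (Christoffel g h i j) U := by
  have hpd : ∀ p q m, ContDiffOn ℝ s (pd p (g q m)) U := fun p q m =>
    contDiffOn_pd hU (hg.contDiff q m) hrs p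
  exact contDiffOn_const.mul (ContDiffOn.sum fun m _ =>
    ((hg.contDiffOn_ginv h m).of_le (le_self_add.trans hrs)).mul
      (((hpd _ _ _).add (hpd _ _ _)).sub (hpd _ _ _)))

theorem IsMetric.christoffel_symm {r : WithTop ℕ∞} (hU : IsOpen U) (hg : IsMetric r g U)
    (h i j : Fin n) {x : Fin n → ℝ} (hx : x ∈ U) :
    Christoffel g h i j x = Christoffel g h j i x := by
  have hpd : ∀ m, pd m (g i j) x = pd m (g j i) x := fun m => by
    have he : g i j =ᶠ[𝓝 x] g j i := by
      filter_upwards [hU.mem_nhds hx] with y hy using hg.symm i j y hy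
    rw [pd, pd, he.fderiv_eq]
  simp only [Christoffel, hpd, add_comm (pd i _ x)]

end Metric

/-- For solutions of the Sinyukov system over a `C^2` metric and distinct indices `i ≠ k`,
the identity `(1/2) ∂_i a^{ii} − ∂_k a^{ik} = a^{kα} Γ^i_{αk} + a^{iα} Γ^k_{αk} − a^{iα} Γ^i_{αi}`
holds, and consequently `∂_k ∂_k a^{ik}` exists and is continuous on `U`. -/
theorem sinyukov_second_derivative_exists
    {n : ℕ} (hn : 2 ≤ n) (U : Set (Fin n → ℝ)) (hU : IsOpen U)
    (g : Fin n → Fin n → (Fin n → ℝ) → ℝ) (hg : IsMetric 2 g U)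
    (a : Fin n → Fin n → (Fin n → ℝ) → ℝ)
    (hasymm : ∀ i j, ∀ x ∈ U, a i j x = a j i x)
    (haC1 : ∀ i j, ContDiffOn ℝ 1 (a i j) U)
    (lam : Fin n → (Fin n → ℝ) → ℝ) (hlam : ∀ i, ContinuousOn (lam i) U)
    (hsin : ∀ i j k, ∀ x ∈ U,
      pd k (a i j) x + (∑ c, Christoffel g i k c x * a c j x)
          + (∑ c, Christoffel g j k c x * a i c x)
        = lam i x * (if j = k then (1:ℝ) else 0) + lam j x * (if i = k then (1:ℝ) else 0)) :
    ∀ i k, i ≠ k →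
      (∀ x ∈ U,
        (1/2) * pd i (a i i) x - pd k (a i k) x
          = ∑ c, (a k c x * Christoffel g i c k x + a i c x * Christoffel g k c k x
              - a i c x * Christoffel g i c i x)) ∧
      ∃ D : (Fin n → ℝ) → ℝ, ContinuousOn D U ∧
        ∀ x ∈ U, HasLineDerivAt ℝ (pd k (a i k)) (D x) x (Pi.single k 1) := by
  intro i k hik
  have hid : ∀ x ∈ U,
      (1/2) * pd i (a i i) x - pd k (a i k) x
        = ∑ c, (a k c x * Christoffel g i c k x + a i c x * Christoffel g k c k x
            - a i c x * Christoffel g i c i x) := by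
    intro x hx
    have h1 := hsin i i i x hx
    have h2 := hsin i k k x hx
    simp only [if_true, if_neg hik, mul_one, mul_zero, add_zero] at h1 h2
    have e1 : ∑ c, Christoffel g i i c x * a c i x = ∑ c, a i c x * Christoffel g i c i x :=
      Finset.sum_congr rfl fun c _ => by
        rw [hasymm c i x hx, hg.christoffel_symm hU i i c hx, mul_comm]
    have e2 : ∑ c, Christoffel g i i c x * a i c x = ∑ c, a i c x * Christoffel g i c i x :=
      Finset.sum_congr rfl fun c _ => by rw [hg.christoffel_symm hU i i c hx, mul_comm]
    have e3 : ∑ c, Christoffel g i k c x * a c k x = ∑ c, a k c x * Christoffel g i c k x :=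
      Finset.sum_congr rfl fun c _ => by
        rw [hasymm c k x hx, hg.christoffel_symm hU i k c hx, mul_comm]
    have e4 : ∑ c, Christoffel g k k c x * a i c x = ∑ c, a i c x * Christoffel g k c k x :=
      Finset.sum_congr rfl fun c _ => by rw [hg.christoffel_symm hU k k c hx, mul_comm]
    rw [e1, e2] at h1
    rw [e3, e4] at h2
    rw [Finset.sum_sub_distrib, Finset.sum_add_distrib]
    linarith
  refine ⟨hid, ?_⟩
  have hΓ : ∀ p q m, ContDiffOn ℝ 1 (Christoffel g p q m) U := fun p q m =>
    hg.contDiffOn_christoffel hU (by norm_num) p q m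
  set R : (Fin n → ℝ) → ℝ := fun x => ∑ c, (a k c x * Christoffel g i c k x
    + a i c x * Christoffel g k c k x - a i c x * Christoffel g i c i x) with hR
  have hRC : ContDiffOn ℝ 1 R U := ContDiffOn.sum fun c _ =>
    (((haC1 _ _).mul (hΓ _ _ _)).add ((haC1 _ _).mul (hΓ _ _ _))).sub ((haC1 _ _).mul (hΓ _ _ _))
  set F : (Fin n → ℝ) → ℝ := fun x => -((∑ c, Christoffel g i k c x * a c i x)
    + ∑ c, Christoffel g i k c x * a i c x) with hF
  have hFC : ContDiffOn ℝ 1 F U :=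
    ((ContDiffOn.sum fun c _ => (hΓ _ _ _).mul (haC1 _ _)).add
      (ContDiffOn.sum fun c _ => (hΓ _ _ _).mul (haC1 _ _))).neg
  have hpdF : ∀ x ∈ U, pd k (a i i) x = F x := fun x hx => by
    have h := hsin i i k x hx
    simp only [if_neg hik, mul_zero, add_zero] at h
    simp only [hF]
    linarith
  refine ⟨fun x => (1/2) * pd i F x - pd k R x, ?_, fun x hx => ?_⟩
  · exact (continuousOn_const.mul (contDiffOn_pd (s := 0) hU hFC (by simp) i).continuousOn).sub
      (contDiffOn_pd (s := 0) hU hRC (by simp) k).continuousOn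
  · have hxU := hU.mem_nhds hx
    have hFs := (hFC.contDiffAt hxU).hasStrictFDerivAt one_ne_zero
    have hline : HasLineDerivAt ℝ (pd i (a i i)) (pd i F x) x (Pi.single k 1) :=
      hasLineDerivAt_fderiv_apply_of_hasStrictFDerivAt
        (by filter_upwards [hxU] with y hy using
          ((haC1 i i).contDiffAt (hU.mem_nhds hy)).differentiableAt one_ne_zero)
        (by filter_upwards [hxU] with y hy using hpdF y hy) hFs
    have hRl : HasLineDerivAt ℝ R (pd k R x) x (Pi.single k 1) :=
      ((hRC.contDiffAt hxU).differentiableAt one_ne_zero).hasFDerivAt.hasLineDerivAt _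
    have hsub : HasLineDerivAt ℝ (fun y => (1/2) * pd i (a i i) y - R y)
        ((1/2) * pd i F x - pd k R x) x (Pi.single k 1) :=
      (HasDerivAt.const_mul (1/2 : ℝ) hline).sub hRl
    refine hsub.congr_of_eventuallyEq ?_
    filter_upwards [hxU] with y hy
    have := hid y hy
    simp only [hR]
    linarith
end
end

section
/- Let n ≥ 2 and let g be a pseudo-Riemannian metric of class C^2 on an open set U ⊆ ℝ^n which is in semigeodesic form, i.e., g_{11} = e with e = 1 or e = −1 constant on U, and g_{1a} = 0 on U for all a ≥ 2. Let a = (a^{ij}) be a symmetric family of functions of class C^1 on U and λ = (λ^i) continuous functions on U satisfying ∂_k a^{ij} + Γ^i_{kα} a^{αj} + Γ^j_{kα} a^{iα} = λ^i δ^j_k + λ^j δ^i_k on U for all i, j, k. Then λ^1 = (1/2) ∂_1 a^{11} on U, and the function Σ_{α,β ≥ 2} a^{αβ} g_{αβ} satisfies ∂_1 (Σ_{α,β ≥ 2} a^{αβ} g_{αβ}) = 0 on U. -/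
noncomputable section
open scoped BigOperators

/-- The first coordinate index (the index "1" of the paper) in `Fin n`, `n ≥ 2`. -/
def fin0 {n : ℕ} (hn : 2 ≤ n) : Fin n := ⟨0, by omega⟩

/-- The partial derivative of a function which is constant on an open set vanishes there. -/
lemma pd_eq_zero_of_eqOn_const {n : ℕ} {U : Set (Fin n → ℝ)} (hU : IsOpen U)
    {f : (Fin n → ℝ) → ℝ} {c : ℝ} (hf : ∀ y ∈ U, f y = c) (k : Fin n) {x : Fin n → ℝ}
    (hx : x ∈ U) : pd k f x = 0 := by
  have h : f =ᶠ[nhds x] fun _ => c := Filter.eventuallyEq_of_mem (hU.mem_nhds hx) hf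
  simp [pd, h.fderiv_eq]

/-- Lowering the upper index of the Christoffel symbols gives the Christoffel symbols of the
first kind. -/
lemma sum_metric_mul_christoffel {n : ℕ} {g : Fin n → Fin n → (Fin n → ℝ) → ℝ}
    {x : Fin n → ℝ} (hdet : IsUnit (matAt g x).det) (d i j : Fin n) :
    ∑ c, g d c x * Christoffel g c i j x
      = (1/2) * (pd i (g j d) x + pd j (g i d) x - pd d (g i j) x) := by
  have hinv : ∀ k, ∑ c, g d c x * ginv g c k x = if d = k then (1:ℝ) else 0 := fun k => by
    have h := congrFun (congrFun (Matrix.mul_nonsing_inv _ hdet) d) k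
    simpa [Matrix.mul_apply, Matrix.one_apply, matAt, ginv] using h
  calc ∑ c, g d c x * Christoffel g c i j x
      = (1/2) * ∑ k, (∑ c, g d c x * ginv g c k x)
          * (pd i (g j k) x + pd j (g i k) x - pd k (g i j) x) := by
        simp only [Christoffel, Finset.mul_sum, Finset.sum_mul]
        rw [Finset.sum_comm]
        exact Finset.sum_congr rfl fun _ _ => Finset.sum_congr rfl fun _ _ => by ring
    _ = _ := by simp [hinv]

/-- For the Sinyukov system in a semigeodesic coordinate system (`g_{11} = e = ±1`,
`g_{1a} = 0` for `a ≥ 2`, the index `1` being the coordinate `fin0 hn` here), one has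
`λ¹ = (1/2) ∂_1 a^{11}` and `∂_1 (a^{αβ} g_{αβ}) = 0`, the sum over `α, β ≥ 2`. -/
theorem sinyukov_semigeodesic
    {n : ℕ} (hn : 2 ≤ n) (U : Set (Fin n → ℝ)) (hU : IsOpen U)
    (g : Fin n → Fin n → (Fin n → ℝ) → ℝ) (hg : IsMetric 2 g U)
    (e : ℝ) (he : e = 1 ∨ e = -1)
    (hsg1 : ∀ x ∈ U, g (fin0 hn) (fin0 hn) x = e)
    (hsg2 : ∀ b : Fin n, b ≠ fin0 hn → ∀ x ∈ U, g (fin0 hn) b x = 0)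
    (a : Fin n → Fin n → (Fin n → ℝ) → ℝ)
    (hasymm : ∀ i j, ∀ x ∈ U, a i j x = a j i x)
    (haC1 : ∀ i j, ContDiffOn ℝ 1 (a i j) U)
    (lam : Fin n → (Fin n → ℝ) → ℝ) (hlam : ∀ i, ContinuousOn (lam i) U)
    (hsin : ∀ i j k, ∀ x ∈ U,
      pd k (a i j) x + (∑ c, Christoffel g i k c x * a c j x)
          + (∑ c, Christoffel g j k c x * a i c x)
        = lam i x * (if j = k then (1:ℝ) else 0) + lam j x * (if i = k then (1:ℝ) else 0)) :
    (∀ x ∈ U, lam (fin0 hn) x = (1/2) * pd (fin0 hn) (a (fin0 hn) (fin0 hn)) x) ∧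
      ∀ x ∈ U,
        HasLineDerivAt ℝ
          (fun y => ∑ c ∈ Finset.univ.erase (fin0 hn), ∑ d ∈ Finset.univ.erase (fin0 hn),
            a c d y * g c d y)
          0 x (Pi.single (fin0 hn) 1) := by
  set o := fin0 hn
  have hg0 : ∀ b, b ≠ o → ∀ y ∈ U, g b o y = 0 := fun b hb y hy => by
    rw [hg.symm b o y hy, hsg2 b hb y hy]
  have hpdl : ∀ k b, ∀ x ∈ U, pd k (g o b) x = 0 := fun k b x hx => by
    by_cases hb : b = o
    · subst hb; exact pd_eq_zero_of_eqOn_const hU hsg1 k hx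
    · exact pd_eq_zero_of_eqOn_const hU (hsg2 b hb) k hx
  have hpdr : ∀ k b, ∀ x ∈ U, pd k (g b o) x = 0 := fun k b x hx => by
    by_cases hb : b = o
    · subst hb; exact pd_eq_zero_of_eqOn_const hU hsg1 k hx
    · exact pd_eq_zero_of_eqOn_const hU (hg0 b hb) k hx
  have hlow : ∀ d m, ∀ x ∈ U,
      ∑ c, g d c x * Christoffel g c o m x = (1/2) * pd o (g m d) x := fun d m x hx => by
    rw [sum_metric_mul_christoffel (hg.inv x hx), hpdl m d x hx, hpdl d m x hx]
    ring
  have he0 : e ≠ 0 := by rcases he with rfl | rfl <;> norm_num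
  have hΓ : ∀ m, ∀ x ∈ U, Christoffel g o o m x = 0 := fun m x hx => by
    have h := hlow o m x hx
    rw [Finset.sum_eq_single o (fun b _ hb => by rw [hsg2 b hb x hx, zero_mul]) (by simp),
      hsg1 x hx, hpdr o m x hx, mul_zero] at h
    exact (mul_eq_zero.mp h).resolve_left he0
  have hlam0 : ∀ x ∈ U, lam o x = (1/2) * pd o (a o o) x := fun x hx => by
    have h := hsin o o o x hx
    simp only [hΓ _ x hx, zero_mul, Finset.sum_const_zero, if_true] at h
    linarith
  refine ⟨hlam0, fun x hx => ?_⟩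
  have hda : ∀ c d, HasFDerivAt (a c d) (fderiv ℝ (a c d) x) x := fun c d =>
    (((haC1 c d).contDiffAt (hU.mem_nhds hx)).differentiableAt (by norm_num)).hasFDerivAt
  have hdg : ∀ c d, HasFDerivAt (g c d) (fderiv ℝ (g c d) x) x := fun c d =>
    (((hg.contDiff c d).contDiffAt (hU.mem_nhds hx)).differentiableAt (by norm_num)).hasFDerivAt
  have hderiv := (HasFDerivAt.fun_sum (u := Finset.univ.erase o) fun c _ =>
    HasFDerivAt.fun_sum (u := Finset.univ.erase o) fun d _ =>
      (hda c d).mul (hdg c d)).hasLineDerivAt (Pi.single o 1)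
  simp only [sum_apply, add_apply, smul_apply, smul_eq_mul] at hderiv
  refine (?_ : (0:ℝ) = _) ▸ hderiv
  change 0 = ∑ c ∈ Finset.univ.erase o, ∑ d ∈ Finset.univ.erase o,
    (a c d x * pd o (g c d) x + g c d x * pd o (a c d) x)
  -- the trace over all indices differs from the transversal one by the `(1,1)` term
  have hsplit : ∑ c, ∑ d, (a c d x * pd o (g c d) x + g c d x * pd o (a c d) x)
      = e * pd o (a o o) x + ∑ c ∈ Finset.univ.erase o, ∑ d ∈ Finset.univ.erase o,
        (a c d x * pd o (g c d) x + g c d x * pd o (a c d) x) := by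
    rw [← Finset.add_sum_erase _ _ (Finset.mem_univ o)]
    congr 1
    · rw [Finset.sum_eq_single o (fun b _ hb => by
        rw [hsg2 b hb x hx, hpdl o b x hx]; ring) (by simp), hsg1 x hx, hpdl o o x hx]
      ring
    · refine Finset.sum_congr rfl fun c hc => ?_
      rw [← Finset.add_sum_erase _ _ (Finset.mem_univ o),
        hg0 c (Finset.ne_of_mem_erase hc) x hx, hpdr o c x hx]
      ring
  have hfirst : ∑ c, ∑ d, g c d x * ∑ m, Christoffel g c o m x * a m d x
      = (1/2) * ∑ c, ∑ d, a c d x * pd o (g c d) x := by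
    calc _ = ∑ d, ∑ m, (∑ c, g d c x * Christoffel g c o m x) * a m d x := by
          rw [Finset.sum_comm]
          refine Finset.sum_congr rfl fun d _ => ?_
          simp only [Finset.mul_sum, Finset.sum_mul]
          rw [Finset.sum_comm]
          refine Finset.sum_congr rfl fun m _ => Finset.sum_congr rfl fun c _ => ?_
          rw [hg.symm c d x hx]
          ring
      _ = _ := by
          simp only [hlow _ _ x hx, Finset.mul_sum]
          rw [Finset.sum_comm]
          exact Finset.sum_congr rfl fun _ _ => Finset.sum_congr rfl fun _ _ => by ring
  have hsecond : ∑ c, ∑ d, g c d x * ∑ m, Christoffel g d o m x * a c m x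
      = (1/2) * ∑ c, ∑ d, a c d x * pd o (g c d) x := by
    rw [← hfirst, Finset.sum_comm]
    refine Finset.sum_congr rfl fun d _ => Finset.sum_congr rfl fun c _ => ?_
    rw [hg.symm c d x hx]
    simp only [hasymm c _ x hx]
  have hrhs : ∑ c, ∑ d, g c d x * (lam c x * (if d = o then (1:ℝ) else 0)
      + lam d x * (if c = o then (1:ℝ) else 0)) = 2 * (e * lam o x) := by
    simp only [mul_add, Finset.sum_add_distrib]
    have h1 : ∑ c, ∑ d, g c d x * (lam c x * (if d = o then (1:ℝ) else 0)) = e * lam o x := by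
      simp only [mul_ite, mul_one, mul_zero, Finset.sum_ite_eq', Finset.mem_univ, if_true]
      rw [Finset.sum_eq_single o (fun b _ hb => by rw [hg0 b hb x hx, zero_mul]) (by simp),
        hsg1 x hx]
    have h2 : ∑ c, ∑ d, g c d x * (lam d x * (if c = o then (1:ℝ) else 0)) = e * lam o x := by
      rw [Finset.sum_comm, ← h1]
      refine Finset.sum_congr rfl fun d _ => Finset.sum_congr rfl fun c _ => ?_
      rw [hg.symm c d x hx]
    rw [h1, h2]
    ring
  have htrace : ∑ c, ∑ d, g c d x * pd o (a c d) x
      = 2 * (e * lam o x) - ∑ c, ∑ d, a c d x * pd o (g c d) x := by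
    have h : ∑ c, ∑ d, g c d x * (pd o (a c d) x + (∑ m, Christoffel g c o m x * a m d x)
        + ∑ m, Christoffel g d o m x * a c m x) = 2 * (e * lam o x) := by
      simp only [hsin _ _ _ x hx, hrhs]
    simp only [mul_add, Finset.sum_add_distrib] at h
    rw [hfirst, hsecond] at h
    linarith
  simp only [Finset.sum_add_distrib] at hsplit htrace ⊢
  rw [htrace, hlam0 x hx] at hsplit
  linarith
end
end
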